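/- (Traveling soliton solutions of the translation-invariant wave–particle system.) Let v ∈ ℝ³ with |v| < 1, let q₀ ∈ ℝ³, let ρ ∈ C_c^∞(ℝ³) be real-valued, and let φ : ℝ³ → ℝ be a C² function with Δφ(x) − (v·∇)²φ(x) = ρ(x) for all x, with |∇φ(x)| ≤ C(1 + |x|)^{−2} and bounded second derivatives. Then ψ(x,t) = φ(x − q₀ − vt), q(t) = q₀ + vt, p(t) = v/√(1 − |v|²) is a solution of the wave–particle system with V ≡ 0: ∂ₜₜψ(x,t) = Δψ(x,t) − ρ(x − q(t)), p(t) = q̇(t)/√(1 − |q̇(t)|²), and ṗ(t) = −∫_{ℝ³} ∇ψ(x,t) ρ(x − q(t)) dx = 0. -/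

import Mathlib

open MeasureTheory

/-- Partial derivative at `x` in the `i`-th coordinate direction. -/
noncomputable def pdR (i : Fin 3) (f : EuclideanSpace ℝ (Fin 3) → ℝ)
    (x : EuclideanSpace ℝ (Fin 3)) : ℝ :=
  deriv (fun s : ℝ => f (x + s • EuclideanSpace.single i (1 : ℝ))) 0

/-- The gradient, as a vector in `ℝ³`, with components the partial derivatives. -/
noncomputable def gradR (f : EuclideanSpace ℝ (Fin 3) → ℝ)
    (x : EuclideanSpace ℝ (Fin 3)) : EuclideanSpace ℝ (Fin 3) :=
  (EuclideanSpace.equiv (Fin 3) ℝ).symm (fun i => pdR i f x)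

/-- The spatial Laplacian: the sum of the three second partial derivatives. -/
noncomputable def lapR (f : EuclideanSpace ℝ (Fin 3) → ℝ)
    (x : EuclideanSpace ℝ (Fin 3)) : ℝ :=
  ∑ i : Fin 3, pdR i (fun y => pdR i f y) x

open Filter Topology

/-- A field in divergence form built from integrable `C¹` potentials, if continuous with compact
support, has vanishing integral. -/
lemma integral_sum_fderiv_eq_zero {E ι : Type*} [NormedAddCommGroup E] [InnerProductSpace ℝ E]
    [FiniteDimensional ℝ E] [MeasurableSpace E] [BorelSpace E] [Fintype ι]
    (c : ι → ℝ) (e : ι → E) (f : ι → E → ℝ) (hf : ∀ m, ContDiff ℝ 1 (f m))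
    (hfi : ∀ m, Integrable (f m))
    (hi : Integrable fun x => ∑ m, c m * fderiv ℝ (f m) x (e m)) :
    ∫ x, ∑ m, c m * fderiv ℝ (f m) x (e m) = 0 := by
  let χ : ContDiffBump (0 : E) := ⟨1, 2, one_pos, one_lt_two⟩
  have hχ1 : ContDiff ℝ 1 χ := χ.contDiff
  have hχd (a : ℝ) (x w : E) :
      fderiv ℝ (fun y => χ (a • y)) x w = a * fderiv ℝ χ (a • x) w := by
    have h : HasFDerivAt (fun y => χ (a • y)) _ x :=
      (hχ1.differentiable one_ne_zero (a • x)).hasFDerivAt.comp x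
        ((hasFDerivAt_id x).const_smul a)
    rw [h.fderiv]
    simp
  obtain ⟨B, hB⟩ := (χ.hasCompactSupport.fderiv ℝ).exists_bound_of_continuous
    (hχ1.continuous_fderiv one_ne_zero)
  have hpos (n : ℕ) : (0 : ℝ) < ((n : ℝ) + 1)⁻¹ := by positivity
  have hcs (n : ℕ) : HasCompactSupport fun y : E => χ (((n : ℝ) + 1)⁻¹ • y) :=
    χ.hasCompactSupport.comp_smul (hpos n).ne'
  have hsm (n : ℕ) : ContDiff ℝ 1 fun y : E => χ (((n : ℝ) + 1)⁻¹ • y) :=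
    hχ1.comp (contDiff_id.const_smul _)
  have hprod (n : ℕ) (m : ι) :
      Integrable fun x => χ (((n : ℝ) + 1)⁻¹ • x) * fderiv ℝ (f m) x (e m) := by
    apply Continuous.integrable_of_hasCompactSupport
    · exact (hsm n).continuous.mul (((hf m).continuous_fderiv one_ne_zero).clm_apply
        continuous_const)
    · exact (hcs n).mul_right
  have hterm (m : ι) : Tendsto (fun n : ℕ =>
      ∫ x, χ (((n : ℝ) + 1)⁻¹ • x) * fderiv ℝ (f m) x (e m)) atTop (𝓝 0) := by
    have hbound : ∀ n : ℕ, ‖∫ x, χ (((n : ℝ) + 1)⁻¹ • x) * fderiv ℝ (f m) x (e m)‖ ≤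
        1 / ((n : ℝ) + 1) * (B * ‖e m‖ * ∫ x, ‖f m x‖) := by
      intro n
      have hder : Continuous fun x => fderiv ℝ (fun y => χ (((n : ℝ) + 1)⁻¹ • y)) x (e m) :=
        ((hsm n).continuous_fderiv one_ne_zero).clm_apply continuous_const
      have hcsd : HasCompactSupport fun x =>
          fderiv ℝ (fun y => χ (((n : ℝ) + 1)⁻¹ • y)) x (e m) :=
        (hcs n).fderiv_apply ℝ (e m)
      rw [integral_mul_fderiv_eq_neg_fderiv_mul_of_integrable
        ((hder.mul (hf m).continuous).integrable_of_hasCompactSupport hcsd.mul_right) (hprod n m)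
        (((hsm n).continuous.mul (hf m).continuous).integrable_of_hasCompactSupport
          (hcs n).mul_right) (fun x _ => (hsm n).differentiable one_ne_zero x)
        (fun x _ => (hf m).differentiable one_ne_zero x), norm_neg]
      rw [← mul_assoc, ← integral_const_mul]
      refine norm_integral_le_of_norm_le ((hfi m).norm.const_mul _) (ae_of_all _ fun x => ?_)
      rw [hχd, norm_mul, norm_mul, Real.norm_of_nonneg (hpos n).le, one_div]
      gcongr
      exact (ContinuousLinearMap.le_opNorm _ _).trans (by gcongr; exact hB _)
    refine squeeze_zero_norm hbound ?_
    simpa using tendsto_one_div_add_atTop_nhds_zero_nat.mul_const (B * ‖e m‖ * ∫ x, ‖f m x‖)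
  have hsum : Tendsto (fun n : ℕ => ∫ x, χ (((n : ℝ) + 1)⁻¹ • x) *
      ∑ m, c m * fderiv ℝ (f m) x (e m)) atTop (𝓝 0) := by
    have h := tendsto_finsetSum Finset.univ fun m _ => (hterm m).const_mul (c m)
    simp only [mul_zero, Finset.sum_const_zero] at h
    refine h.congr fun n => ?_
    simp only [← integral_const_mul]
    rw [← integral_finsetSum _ fun m _ => (hprod n m).const_mul (c m)]
    congr 1 with x
    rw [Finset.mul_sum]
    exact Finset.sum_congr rfl fun m _ => by ring
  refine tendsto_nhds_unique ?_ hsum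
  refine tendsto_integral_of_dominated_convergence _
    (fun n => (hsm n).continuous.aestronglyMeasurable.mul hi.aestronglyMeasurable) hi.norm
    (fun n => ae_of_all _ fun x => ?_) (ae_of_all _ fun x => ?_)
  · rw [norm_mul, Real.norm_of_nonneg χ.nonneg]
    exact mul_le_of_le_one_left (norm_nonneg _) χ.le_one
  · have h : Tendsto (fun n : ℕ => χ (((n : ℝ) + 1)⁻¹ • x)) atTop (𝓝 (χ ((0 : ℝ) • x))) := by
      refine (hχ1.continuous.tendsto _).comp (Tendsto.smul_const ?_ x)
      simpa using tendsto_one_div_add_atTop_nhds_zero_nat (𝕜 := ℝ)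
    rw [zero_smul, χ.one_of_mem_closedBall (by simp [χ])] at h
    simpa using h.mul_const (∑ m, c m * fderiv ℝ (f m) x (e m))

lemma pdR_eq_fderiv {f : EuclideanSpace ℝ (Fin 3) → ℝ} {x : EuclideanSpace ℝ (Fin 3)}
    (hf : DifferentiableAt ℝ f x) (i : Fin 3) :
    pdR i f x = fderiv ℝ f x (EuclideanSpace.single i 1) :=
  hf.lineDeriv_eq_fderiv

lemma pdR_comp_sub (f : EuclideanSpace ℝ (Fin 3) → ℝ) (a x : EuclideanSpace ℝ (Fin 3))
    (i : Fin 3) : pdR i (fun y => f (y - a)) x = pdR i f (x - a) := by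
  simp only [pdR, add_sub_right_comm]

lemma gradR_comp_sub (f : EuclideanSpace ℝ (Fin 3) → ℝ) (a x : EuclideanSpace ℝ (Fin 3)) :
    gradR (fun y => f (y - a)) x = gradR f (x - a) := by
  simp only [gradR, pdR_comp_sub]

lemma lapR_comp_sub (f : EuclideanSpace ℝ (Fin 3) → ℝ) (a x : EuclideanSpace ℝ (Fin 3)) :
    lapR (fun y => f (y - a)) x = lapR f (x - a) := by
  simp only [lapR, pdR_comp_sub]

section SecondOrder

variable {f : EuclideanSpace ℝ (Fin 3) → ℝ}

lemma pdR_fun_eq_fderiv (hf : Differentiable ℝ f) (i : Fin 3) :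
    pdR i f = fun x => fderiv ℝ f x (EuclideanSpace.single i 1) :=
  funext fun x => pdR_eq_fderiv (hf x) i

lemma contDiff_pdR (hf : ContDiff ℝ 2 f) (i : Fin 3) : ContDiff ℝ 1 (pdR i f) := by
  rw [pdR_fun_eq_fderiv (hf.differentiable two_ne_zero)]
  exact (hf.fderiv_right (by norm_num)).clm_apply contDiff_const

lemma pdR_pdR_eq_fderiv (hf : ContDiff ℝ 2 f) (i j : Fin 3) (x : EuclideanSpace ℝ (Fin 3)) :
    pdR i (pdR j f) x =
      fderiv ℝ (fderiv ℝ f) x (EuclideanSpace.single i 1) (EuclideanSpace.single j 1) := by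
  have h : DifferentiableAt ℝ (fderiv ℝ f) x :=
    (hf.fderiv_right (m := 1) (by norm_num)).differentiable one_ne_zero x
  rw [pdR_eq_fderiv ((contDiff_pdR hf j).differentiable one_ne_zero x),
    pdR_fun_eq_fderiv (hf.differentiable two_ne_zero),
    (h.hasFDerivAt.clm_apply (hasFDerivAt_const _ x)).fderiv]
  simp

lemma pdR_comm (hf : ContDiff ℝ 2 f) (i j : Fin 3) (x : EuclideanSpace ℝ (Fin 3)) :
    pdR i (pdR j f) x = pdR j (pdR i f) x := by
  rw [pdR_pdR_eq_fderiv hf, pdR_pdR_eq_fderiv hf]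
  exact hf.contDiffAt.isSymmSndFDerivAt (by simp) _ _

lemma deriv_deriv_comp_sub_smul (hf : ContDiff ℝ 2 f) (a v : EuclideanSpace ℝ (Fin 3)) (t : ℝ) :
    deriv (deriv fun s : ℝ => f (a - s • v)) t =
      ∑ j : Fin 3, ∑ k : Fin 3, v j * v k * pdR j (pdR k f) (a - t • v) := by
  have hline (s : ℝ) : HasDerivAt (fun s : ℝ => a - s • v) (-v) s := by
    simpa using ((hasDerivAt_id s).smul_const v).const_sub a
  have h1 : (deriv fun s : ℝ => f (a - s • v)) = fun s => fderiv ℝ f (a - s • v) (-v) :=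
    funext fun s => ((hf.differentiable two_ne_zero _).hasFDerivAt.comp_hasDerivAt s
      (hline s)).deriv
  have hd : HasDerivAt (fun s : ℝ => fderiv ℝ f (a - s • v))
      (fderiv ℝ (fderiv ℝ f) (a - t • v) (-v)) t :=
    ((hf.fderiv_right (m := 1) (by norm_num)).differentiable one_ne_zero
      (a - t • v)).hasFDerivAt.comp_hasDerivAt t (hline t)
  have h2 : HasDerivAt (fun s : ℝ => fderiv ℝ f (a - s • v) (-v))
      (fderiv ℝ (fderiv ℝ f) (a - t • v) (-v) (-v)) t := by
    simpa using hd.clm_apply (hasDerivAt_const t (-v))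
  have hv : v = ∑ j : Fin 3, v j • EuclideanSpace.single j (1 : ℝ) := by
    ext i; fin_cases i <;> simp [Fin.sum_univ_three]
  have h3 : fderiv ℝ (fderiv ℝ f) (a - t • v) v v =
      ∑ j : Fin 3, ∑ k : Fin 3, v j * v k * pdR j (pdR k f) (a - t • v) := by
    generalize a - t • v = x
    simp only [pdR_pdR_eq_fderiv hf]
    conv_lhs => rw [hv]
    simp [Finset.mul_sum, mul_assoc]
    rw [Finset.sum_comm]
    exact Finset.sum_congr rfl fun j _ => Finset.sum_congr rfl fun k _ => mul_left_comm _ _ _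
  rw [h1, h2.deriv, ← h3]
  simp

lemma pdR_mul_pdR_fderiv (hf : ContDiff ℝ 2 f) (j k l : Fin 3) (x : EuclideanSpace ℝ (Fin 3)) :
    fderiv ℝ (fun y => pdR k f y * pdR l f y) x (EuclideanSpace.single j 1) =
      pdR k f x * pdR j (pdR l f) x + pdR l f x * pdR j (pdR k f) x := by
  have h (k : Fin 3) := (contDiff_pdR hf k).differentiable one_ne_zero x
  rw [fderiv_fun_mul (h k) (h l), pdR_eq_fderiv (h k), pdR_eq_fderiv (h l)]
  simp

lemma abs_pdR_le_norm_gradR (i : Fin 3) (x : EuclideanSpace ℝ (Fin 3)) :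
    |pdR i f x| ≤ ‖gradR f x‖ :=
  PiLp.norm_apply_le (gradR f x) i

lemma integrable_pdR_mul_pdR (hf : ContDiff ℝ 2 f) {C : ℝ}
    (hdecay : ∀ x, ‖gradR f x‖ ≤ C / (1 + ‖x‖) ^ 2) (k l : Fin 3) :
    Integrable fun x => pdR k f x * pdR l f x := by
  have hint : Integrable fun x : EuclideanSpace ℝ (Fin 3) => (1 + ‖x‖) ^ (-(4 : ℝ)) :=
    integrable_one_add_norm (by simp; norm_num)
  refine (hint.const_mul (C ^ 2)).mono'
    ((contDiff_pdR hf k).continuous.mul (contDiff_pdR hf l).continuous).aestronglyMeasurable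
    (ae_of_all _ fun x => ?_)
  have hx : 0 < 1 + ‖x‖ := by positivity
  have h (k : Fin 3) := (abs_pdR_le_norm_gradR k x).trans (hdecay x)
  rw [Real.norm_eq_abs, abs_mul, Real.rpow_neg hx.le]
  refine (mul_le_mul (h k) (h l) (abs_nonneg _) ((abs_nonneg _).trans (h k))).trans_eq ?_
  norm_cast
  field_simp

lemma continuous_gradR (hf : ContDiff ℝ 2 f) : Continuous (gradR f) :=
  (EuclideanSpace.equiv (Fin 3) ℝ).symm.continuous.comp
    (continuous_pi fun i => (contDiff_pdR hf i).continuous)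

/-- The self-force of a source of the operator `Δ − (v·∇)²` vanishes. -/
lemma integral_smul_gradR_eq_zero (hf : ContDiff ℝ 2 f) {C : ℝ}
    (hdecay : ∀ x, ‖gradR f x‖ ≤ C / (1 + ‖x‖) ^ 2) (v : EuclideanSpace ℝ (Fin 3))
    {ρ : EuclideanSpace ℝ (Fin 3) → ℝ} (hρ : Continuous ρ) (hρc : HasCompactSupport ρ)
    (heq : ∀ x, (∑ i : Fin 3, pdR i (pdR i f) x)
      - (∑ j : Fin 3, ∑ k : Fin 3, v j * v k * pdR j (pdR k f) x) = ρ x) :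
    ∫ x, ρ x • gradR f x = 0 := by
  have hint : Integrable fun x => ρ x • gradR f x :=
    (hρ.smul (continuous_gradR hf)).integrable_of_hasCompactSupport hρc.smul_right
  ext i
  have hcomp := (EuclideanSpace.proj i : EuclideanSpace ℝ (Fin 3) →L[ℝ] ℝ).integral_comp_comm hint
  refine hcomp.symm.trans ?_
  change ∫ x, ρ x * pdR i f x = 0
  have hinti : Integrable fun x => ρ x * pdR i f x :=
    (hρ.mul (contDiff_pdR hf i).continuous).integrable_of_hasCompactSupport hρc.mul_right
  let a (j k : Fin 3) : ℝ := (if j = k then 1 else 0) - v j * v k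
  let c (m : Fin 3 × Fin 3 × Fin 3) : ℝ :=
    (if m.2.1 = i then a m.1 m.2.2 else 0) - (if m.1 = i then a m.2.1 m.2.2 / 2 else 0)
  have hdiv : (fun x => ρ x * pdR i f x) = fun x => ∑ m : Fin 3 × Fin 3 × Fin 3, c m *
      fderiv ℝ (fun y => pdR m.2.1 f y * pdR m.2.2 f y) x (EuclideanSpace.single m.1 1) := by
    funext x
    simp only [pdR_mul_pdR_fderiv hf, Fintype.sum_prod_type, ← heq]
    have h10 := pdR_comm hf 1 0 x
    have h20 := pdR_comm hf 2 0 x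
    have h21 := pdR_comm hf 2 1 x
    fin_cases i <;> simp [Fin.sum_univ_three, c, a, h10, h20, h21] <;> ring
  rw [hdiv] at hinti ⊢
  exact integral_sum_fderiv_eq_zero c _ _
    (fun m => (contDiff_pdR hf m.2.1).mul (contDiff_pdR hf m.2.2))
    (fun m => integrable_pdR_mul_pdR hf hdecay m.2.1 m.2.2) hinti

end SecondOrder

/-- **Traveling soliton solutions of the translation-invariant wave–particle system.**
If `φ` solves the comoving-frame equation `Δφ − (v·∇)²φ = ρ` (with `|v| < 1`,
suitable decay of `∇φ` and bounded second derivatives), then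
`ψ(x,t) = φ(x − q₀ − vt)`, `q(t) = q₀ + vt`, `p(t) = v/√(1 − |v|²)` solves the
wave–particle system with `V ≡ 0`: the wave equation holds, `p = q̇/√(1 − |q̇|²)`,
and `ṗ(t) = −∫ ∇ψ(x,t) ρ(x − q(t)) dx = 0`. -/
theorem traveling_soliton_wave_particle
    (v : EuclideanSpace ℝ (Fin 3)) (hv : ‖v‖ < 1) (q₀ : EuclideanSpace ℝ (Fin 3))
    (ρ : EuclideanSpace ℝ (Fin 3) → ℝ) (hρ : ContDiff ℝ (⊤ : ℕ∞) ρ) (hρc : HasCompactSupport ρ)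
    (φ : EuclideanSpace ℝ (Fin 3) → ℝ) (hφ : ContDiff ℝ 2 φ)
    (heq : ∀ x : EuclideanSpace ℝ (Fin 3),
      (∑ i : Fin 3, pdR i (fun y => pdR i φ y) x)
        - (∑ j : Fin 3, ∑ k : Fin 3, v j * v k * pdR j (fun y => pdR k φ y) x)
      = ρ x)
    (C : ℝ) (hC : 0 < C)
    (hdecay : ∀ x : EuclideanSpace ℝ (Fin 3), ‖gradR φ x‖ ≤ C / (1 + ‖x‖) ^ 2)
    (M : ℝ)
    (hM : ∀ (x : EuclideanSpace ℝ (Fin 3)) (i j : Fin 3),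
      |pdR i (fun y => pdR j φ y) x| ≤ M) :
    (∀ (x : EuclideanSpace ℝ (Fin 3)) (t : ℝ),
      deriv (deriv (fun s : ℝ => φ (x - q₀ - s • v))) t
        = lapR (fun y => φ (y - q₀ - t • v)) x - ρ (x - (q₀ + t • v)))
    ∧ (∀ t : ℝ,
        (1 / Real.sqrt (1 - ‖v‖ ^ 2)) • v
          = (1 / Real.sqrt (1 - ‖deriv (fun s : ℝ => q₀ + s • v) t‖ ^ 2))
              • deriv (fun s : ℝ => q₀ + s • v) t)
    ∧ (∀ t : ℝ,
        deriv (fun _ : ℝ => (1 / Real.sqrt (1 - ‖v‖ ^ 2)) • v) t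
          = -∫ x : EuclideanSpace ℝ (Fin 3),
              ρ (x - (q₀ + t • v)) • gradR (fun y => φ (y - q₀ - t • v)) x)
    ∧ (∀ t : ℝ,
        (∫ x : EuclideanSpace ℝ (Fin 3),
            ρ (x - (q₀ + t • v)) • gradR (fun y => φ (y - q₀ - t • v)) x) = 0) := by
  have hforce (t : ℝ) : (∫ x : EuclideanSpace ℝ (Fin 3),
      ρ (x - (q₀ + t • v)) • gradR (fun y => φ (y - q₀ - t • v)) x) = 0 := by
    simp only [sub_sub, gradR_comp_sub]
    rw [integral_sub_right_eq_self (fun x => ρ x • gradR φ x) (q₀ + t • v)]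
    exact integral_smul_gradR_eq_zero hφ hdecay v hρ.continuous hρc heq
  refine ⟨fun x t => ?_, fun t => ?_, fun t => ?_, hforce⟩
  · rw [deriv_deriv_comp_sub_smul hφ]
    simp only [sub_sub, lapR_comp_sub]
    rw [← heq, lapR]
    ring
  · have h : deriv (fun s : ℝ => q₀ + s • v) t = v := by
      simpa using (((hasDerivAt_id t).smul_const v).const_add q₀).deriv
    rw [h]
  · rw [hforce, deriv_const, neg_zero]
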